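/- arXiv:1010.1029 — 2 statements merged into one kernel-verified Lean document; each statement's English description precedes it below -/
import Mathlib

section
/- For every n, M ∈ ℕ and every A ∈ σ(𝒜ⁿ) with μ(A) > 0 one has ℙ_A(τ_A ∘ T^{n−1} ≤ M) ≤ n·δ_A(n) + M·μ(A) + ᾱ(n); moreover, if M ≤ n then already ℙ_A(τ_A ∘ T^{n−1} ≤ M) ≤ n·δ_A(n). -/
open MeasureTheory Filter Set

/-- `A` is an `n`-cylinder for the map `T` and the partition `𝒜`:
an element of the join `⋁_{j=0}^{n-1} T^{-j}𝒜`. -/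
def IsCylinder {Ω : Type*} (T : Ω → Ω) (𝒜 : Set (Set Ω)) (n : ℕ) (A : Set Ω) : Prop :=
  ∃ f : ℕ → Set Ω, (∀ j < n, f j ∈ 𝒜) ∧ A = ⋂ j ∈ Finset.range n, T^[j] ⁻¹' f j

/-- `A` is a countable union of `n`-cylinders, i.e. `A ∈ σ(𝒜ⁿ)`. -/
def IsCylinderUnion {Ω : Type*} (T : Ω → Ω) (𝒜 : Set (Set Ω)) (n : ℕ) (A : Set Ω) : Prop :=
  ∃ 𝒞 : Set (Set Ω), 𝒞.Countable ∧ (∀ C ∈ 𝒞, IsCylinder T 𝒜 n C) ∧ A = ⋃₀ 𝒞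

/-- The σ-algebra generated by all cylinders `⋃_ℓ 𝒜^ℓ`. -/
def cylinderSigma {Ω : Type*} (T : Ω → Ω) (𝒜 : Set (Set Ω)) : MeasurableSpace Ω :=
  MeasurableSpace.generateFrom {S | ∃ ℓ, IsCylinder T 𝒜 ℓ S}

/-- `μ` is α-mixing for `T` with respect to the partition `𝒜`:
`|μ(A ∩ T^{-n-k}B) − μ(A)μ(B)| ≤ α(k) μ(B)` for every union `A` of `n`-cylinders and every
`B` in the σ-algebra generated by all cylinders. -/
def AlphaMixing {Ω : Type*} [MeasurableSpace Ω] (μ : Measure Ω) (T : Ω → Ω)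
    (𝒜 : Set (Set Ω)) (α : ℕ → ℝ) : Prop :=
  ∀ n k : ℕ, ∀ A B : Set Ω, IsCylinderUnion T 𝒜 n A →
    MeasurableSet[cylinderSigma T 𝒜] B →
    |(μ (A ∩ T^[n + k] ⁻¹' B)).toReal - (μ A).toReal * (μ B).toReal| ≤ α k * (μ B).toReal

/-- `A^{(w)}`: the smallest union of `w`-cylinders containing `A`. -/
def cylinderHull {Ω : Type*} (T : Ω → Ω) (𝒜 : Set (Set Ω)) (w : ℕ) (A : Set Ω) : Set Ω :=
  ⋃₀ {C | IsCylinder T 𝒜 w C ∧ (C ∩ A).Nonempty}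

/-- `δ_A(k) = min_{1 ≤ w ≤ k} ( μ(A^{(w)}) + α(k−w) )`. -/
noncomputable def deltaA {Ω : Type*} [MeasurableSpace Ω] (μ : Measure Ω) (T : Ω → Ω)
    (𝒜 : Set (Set Ω)) (α : ℕ → ℝ) (A : Set Ω) (k : ℕ) : ℝ :=
  sInf ((fun w => (μ (cylinderHull T 𝒜 w A)).toReal + α (k - w)) '' Set.Icc 1 k)

/-- `ᾱ(n) = Σ_{j=n}^∞ α(j)`. -/
noncomputable def alphaBar (α : ℕ → ℝ) (n : ℕ) : ℝ := ∑' j : ℕ, α (n + j)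

/-- The hitting time `τ_A(x) = inf {k ≥ 1 : T^k x ∈ A}` (with value `⊤` if the orbit
never enters `A`). -/
noncomputable def hitTime {Ω : Type*} (T : Ω → Ω) (A : Set Ω) (x : Ω) : ℕ∞ :=
  sInf {ℓ : ℕ∞ | ∃ m : ℕ, ℓ = (m : ℕ∞) ∧ 1 ≤ m ∧ T^[m] x ∈ A}

/-- The `k`-th hitting time `τ_A^k`. -/
noncomputable def hitTimeK {Ω : Type*} (T : Ω → Ω) (A : Set Ω) : ℕ → Ω → ℕ∞
  | 0, _ => 0
  | k + 1, x =>
      sInf {ℓ : ℕ∞ | ∃ m : ℕ, ℓ = (m : ℕ∞) ∧ hitTimeK T A k x < (m : ℕ∞) ∧ T^[m] x ∈ A}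

/-- The recurrence time `r_A = inf {j ≥ 1 : A ∩ T^{-j}A ≠ ∅}`. -/
noncomputable def recTime {Ω : Type*} (T : Ω → Ω) (A : Set Ω) : ℕ :=
  sInf {j : ℕ | 1 ≤ j ∧ (A ∩ T^[j] ⁻¹' A).Nonempty}

/-- `W_m(x) = Σ_{j=1}^m 1_A(T^j x)`, the number of visits to `A` up to time `m`. -/
noncomputable def visits {Ω : Type*} (T : Ω → Ω) (A : Set Ω) (m : ℕ) (x : Ω) : ℕ :=
  ∑ j ∈ Finset.Icc 1 m, A.indicator (fun _ => 1) (T^[j] x)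

/-- `W_m^i(x) = Σ_{1 ≤ j ≤ m, j ≠ i} 1_A(T^j x)`. -/
noncomputable def visitsAvoid {Ω : Type*} (T : Ω → Ω) (A : Set Ω) (m i : ℕ) (x : Ω) : ℕ :=
  ∑ j ∈ (Finset.Icc 1 m).erase i, A.indicator (fun _ => 1) (T^[j] x)


theorem aux_countable_cyl {Ω : Type*} (T : Ω → Ω) (𝒜 : Set (Set Ω)) (hcnt : 𝒜.Countable)
    (w : ℕ) : {C | IsCylinder T 𝒜 w C}.Countable := by
  haveI : Countable 𝒜 := hcnt.to_subtype
  refine (Set.countable_range (fun g : Fin w → 𝒜 =>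
    ⋂ j : Fin w, T^[(j : ℕ)] ⁻¹' (g j : Set Ω))).mono ?_
  rintro C ⟨f, hf, rfl⟩
  refine ⟨fun j => ⟨f j, hf j j.2⟩, ?_⟩
  ext x
  simp only [Set.mem_iInter, Finset.mem_range]
  exact ⟨fun h i hi => h ⟨i, hi⟩, fun h i => h i i.2⟩

theorem aux_hull_union {Ω : Type*} (T : Ω → Ω) (𝒜 : Set (Set Ω)) (hcnt : 𝒜.Countable)
    (w : ℕ) (A : Set Ω) : IsCylinderUnion T 𝒜 w (cylinderHull T 𝒜 w A) :=
  ⟨_, (aux_countable_cyl T 𝒜 hcnt w).mono (fun _ h => h.1), fun _ h => h.1, rfl⟩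

theorem aux_subset_hull {Ω : Type*} (T : Ω → Ω) (𝒜 : Set (Set Ω)) (hcov : ⋃₀ 𝒜 = Set.univ)
    (w : ℕ) (A : Set Ω) : A ⊆ cylinderHull T 𝒜 w A := by
  intro x hx
  have h : ∀ j : ℕ, ∃ s ∈ 𝒜, T^[j] x ∈ s := fun j => by
    have : T^[j] x ∈ ⋃₀ 𝒜 := by rw [hcov]; trivial
    exact this
  choose f hf hxf using h
  have hmem : x ∈ ⋂ j ∈ Finset.range w, T^[j] ⁻¹' f j := by
    simp only [Set.mem_iInter]
    exact fun i _ => hxf i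
  exact ⟨_, ⟨⟨f, fun j _ => hf j, rfl⟩, x, hmem, hx⟩, hmem⟩

theorem aux_meas {Ω : Type*} (T : Ω → Ω) (𝒜 : Set (Set Ω)) (n : ℕ) (A : Set Ω)
    (hA : IsCylinderUnion T 𝒜 n A) : MeasurableSet[cylinderSigma T 𝒜] A := by
  obtain ⟨𝒞, hc, h, rfl⟩ := hA
  exact MeasurableSet.sUnion hc
    (fun C hC => MeasurableSpace.measurableSet_generateFrom ⟨n, h C hC⟩)

theorem aux_key {Ω : Type*} [MeasurableSpace Ω] (μ : Measure Ω) [IsProbabilityMeasure μ]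
    (T : Ω → Ω) (𝒜 : Set (Set Ω)) (α : ℕ → ℝ) (hmix : AlphaMixing μ T 𝒜 α)
    (A B H : Set Ω) (w k : ℕ) (hH : IsCylinderUnion T 𝒜 w H) (hAH : A ⊆ H)
    (hB : MeasurableSet[cylinderSigma T 𝒜] B) :
    (μ (A ∩ T^[w + k] ⁻¹' B)).toReal ≤ ((μ H).toReal + α k) * (μ B).toReal := by
  have h1 := (abs_le.mp (hmix w k H B hH hB)).2
  have h2 : (μ (A ∩ T^[w + k] ⁻¹' B)).toReal ≤ (μ (H ∩ T^[w + k] ⁻¹' B)).toReal :=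
    ENNReal.toReal_mono (measure_ne_top _ _) (measure_mono (Set.inter_subset_inter_left _ hAH))
  linarith

theorem aux_hit {Ω : Type*} [MeasurableSpace Ω] (μ : Measure Ω) [IsProbabilityMeasure μ]
    (T : Ω → Ω) (A : Set Ω) (n M : ℕ) (hn : 1 ≤ n) :
    (μ (A ∩ {x | hitTime T A (T^[n - 1] x) ≤ (M : ℕ∞)})).toReal ≤
      ∑ i ∈ Finset.range M, (μ (A ∩ T^[n + i] ⁻¹' A)).toReal := by
  have hsub : A ∩ {x | hitTime T A (T^[n - 1] x) ≤ (M : ℕ∞)} ⊆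
      ⋃ i ∈ Finset.range M, (A ∩ T^[n + i] ⁻¹' A) := by
    rintro x ⟨hxA, hx⟩
    have hlt : hitTime T A (T^[n - 1] x) < ((M + 1 : ℕ) : ℕ∞) :=
      lt_of_le_of_lt hx (by exact_mod_cast Nat.lt_succ_self M)
    obtain ⟨l, ⟨m, rfl, hm1, hm⟩, hl⟩ := sInf_lt_iff.mp hlt
    have hmM : m < M + 1 := by exact_mod_cast hl
    simp only [Set.mem_iUnion, Finset.mem_range]
    refine ⟨m - 1, by omega, hxA, ?_⟩
    rw [← Function.iterate_add_apply] at hm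
    have : n + (m - 1) = m + (n - 1) := by omega
    rw [Set.mem_preimage, this]
    exact hm
  rw [← ENNReal.toReal_sum (fun i _ => measure_ne_top _ _)]
  refine ENNReal.toReal_mono ?_ ((measure_mono hsub).trans (measure_biUnion_finset_le _ _))
  exact ENNReal.sum_ne_top.mpr (fun i _ => measure_ne_top _ _)

/-- For every `n, M ∈ ℕ` and every `A ∈ σ(𝒜ⁿ)` with `μ(A) > 0` one has
`ℙ_A(τ_A ∘ T^{n−1} ≤ M) ≤ n·δ_A(n) + M·μ(A) + ᾱ(n)`; moreover, if `M ≤ n` then already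
`ℙ_A(τ_A ∘ T^{n−1} ≤ M) ≤ n·δ_A(n)`. -/
theorem cond_prob_short_return_after_shift
    {Ω : Type*} [MeasurableSpace Ω] (μ : Measure Ω) [IsProbabilityMeasure μ]
    (T : Ω → Ω) (hT : MeasurePreserving T μ μ)
    (𝒜 : Set (Set Ω)) (hcnt : 𝒜.Countable) (hms : ∀ s ∈ 𝒜, MeasurableSet s)
    (hdisj : 𝒜.PairwiseDisjoint id) (hcov : ⋃₀ 𝒜 = Set.univ)
    (α : ℕ → ℝ) (hanti : Antitone α) (hα_lim : Tendsto α atTop (nhds 0)) (hα0 : α 0 = 1)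
    (hsum : Summable α)
    (hmix : AlphaMixing μ T 𝒜 α) :
    ∀ n M : ℕ, 1 ≤ n → ∀ A : Set Ω, IsCylinderUnion T 𝒜 n A → 0 < μ A →
      ((μ (A ∩ {x | hitTime T A (T^[n - 1] x) ≤ (M : ℕ∞)})).toReal / (μ A).toReal ≤
          n * deltaA μ T 𝒜 α A n + M * (μ A).toReal + alphaBar α n) ∧
      (M ≤ n →
        (μ (A ∩ {x | hitTime T A (T^[n - 1] x) ≤ (M : ℕ∞)})).toReal / (μ A).toReal ≤
          n * deltaA μ T 𝒜 α A n) := by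
  intro n M hn A hA hpos
  have hA0 : 0 < (μ A).toReal := ENNReal.toReal_pos hpos.ne' (measure_ne_top _ _)
  have hαnn : ∀ k, 0 ≤ α k := fun k => hanti.le_of_tendsto hα_lim k
  have hmeas := aux_meas T 𝒜 n A hA
  have hhit := aux_hit μ T A n M hn
  have hmem : deltaA μ T 𝒜 α A n ∈
      (fun w => (μ (cylinderHull T 𝒜 w A)).toReal + α (n - w)) '' Set.Icc 1 n :=
    Set.Nonempty.csInf_mem ⟨_, 1, ⟨le_refl 1, hn⟩, rfl⟩ ((Set.finite_Icc 1 n).image _)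
  obtain ⟨w, ⟨hw1, hwn⟩, hw⟩ := hmem
  simp only at hw
  have hδ0 : 0 ≤ deltaA μ T 𝒜 α A n := by
    rw [← hw]; exact add_nonneg ENNReal.toReal_nonneg (hαnn _)
  have hterm1 : ∀ i, (μ (A ∩ T^[n + i] ⁻¹' A)).toReal ≤
      deltaA μ T 𝒜 α A n * (μ A).toReal := by
    intro i
    have h := aux_key μ T 𝒜 α hmix A A _ w (n + i - w) (aux_hull_union T 𝒜 hcnt w A)
      (aux_subset_hull T 𝒜 hcov w A) hmeas
    have e : w + (n + i - w) = n + i := by omega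
    rw [e] at h
    refine h.trans (mul_le_mul_of_nonneg_right ?_ hA0.le)
    rw [← hw]
    have := hanti (show n - w ≤ n + i - w by omega)
    linarith
  have hterm2 : ∀ i, (μ (A ∩ T^[n + i] ⁻¹' A)).toReal ≤
      ((μ A).toReal + α i) * (μ A).toReal := fun i =>
    aux_key μ T 𝒜 α hmix A A A n i hA subset_rfl hmeas
  have hsmall : ∀ K ≤ n, ∑ i ∈ Finset.range K, (μ (A ∩ T^[n + i] ⁻¹' A)).toReal ≤
      (n * deltaA μ T 𝒜 α A n) * (μ A).toReal := by
    intro K hK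
    calc _ ≤ ∑ i ∈ Finset.range K, deltaA μ T 𝒜 α A n * (μ A).toReal :=
          Finset.sum_le_sum (fun i _ => hterm1 i)
      _ = K * (deltaA μ T 𝒜 α A n * (μ A).toReal) := by simp
      _ ≤ n * (deltaA μ T 𝒜 α A n * (μ A).toReal) :=
          mul_le_mul_of_nonneg_right (by exact_mod_cast hK) (mul_nonneg hδ0 hA0.le)
      _ = _ := by ring
  have hbar0 : 0 ≤ alphaBar α n := tsum_nonneg (fun j => hαnn _)
  have hfin : M ≤ n →
        (μ (A ∩ {x | hitTime T A (T^[n - 1] x) ≤ (M : ℕ∞)})).toReal / (μ A).toReal ≤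
          n * deltaA μ T 𝒜 α A n := fun hM => by
    rw [div_le_iff₀ hA0]
    exact hhit.trans (hsmall M hM)
  refine ⟨?_, hfin⟩
  rcases le_total M n with hM | hM
  · have h1 := hfin hM
    have h2 : 0 ≤ (M : ℝ) * (μ A).toReal := by positivity
    linarith
  · rw [div_le_iff₀ hA0]
    refine hhit.trans ?_
    obtain ⟨K, rfl⟩ := Nat.exists_eq_add_of_le hM
    rw [Finset.sum_range_add]
    have h1 := hsmall n le_rfl
    have hs : Summable (fun j => α (n + j)) := by
      simpa [add_comm] using (summable_nat_add_iff n).mpr hsum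
    have h3 : ∑ i ∈ Finset.range K, α (n + i) ≤ alphaBar α n :=
      hs.sum_le_tsum _ (fun i _ => hαnn _)
    have h2 : ∑ i ∈ Finset.range K, (μ (A ∩ T^[n + (n + i)] ⁻¹' A)).toReal ≤
        (K * (μ A).toReal + alphaBar α n) * (μ A).toReal := by
      calc _ ≤ ∑ i ∈ Finset.range K, ((μ A).toReal + α (n + i)) * (μ A).toReal :=
            Finset.sum_le_sum (fun i _ => hterm2 (n + i))
        _ = (K * (μ A).toReal + ∑ i ∈ Finset.range K, α (n + i)) * (μ A).toReal := by
            rw [← Finset.sum_mul, Finset.sum_add_distrib]; simp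
        _ ≤ _ := mul_le_mul_of_nonneg_right (by linarith) hA0.le
    have h4 : 0 ≤ (n : ℝ) * (μ A).toReal * (μ A).toReal := by positivity
    push_cast
    nlinarith
end

section
/- Assume ᾱ(n) = Σ_{j=n}^∞ α(j) < ∞. There exists a constant C > 0 such that for all n ∈ ℕ, all A ∈ σ(𝒜ⁿ) with μ(A) > 0 and recurrence time r_A > n/2, all m ∈ ℕ, all i ∈ {1, …, m} and all integers a with 0 ≤ a ≤ m−1: |μ({W_m^i = a} ∩ T^{−i}A) − μ(W_m^i = a)·μ(A)| ≤ C·μ(A)·inf_{Δ∈ℕ} ( Δ·μ(A) + n·μ(A) + n·δ_A(n) + n·δ_A(r_A) + ᾱ(n) + α(Δ)/μ(A) ). -/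
open MeasureTheory Filter Set

section Helpers

variable {Ω : Type*}

/-- `S` is saturated for the relation of lying in the same `N`-cylinder. -/
def CylSat (T : Ω → Ω) (𝒜 : Set (Set Ω)) (N : ℕ) (S : Set Ω) : Prop :=
  ∀ x y, (∀ j < N, ∀ s ∈ 𝒜, T^[j] x ∈ s → T^[j] y ∈ s) → x ∈ S → y ∈ S

lemma IsCylinderUnion.cylSat {T : Ω → Ω} {𝒜 : Set (Set Ω)} {N : ℕ} {S : Set Ω}
    (h : IsCylinderUnion T 𝒜 N S) : CylSat T 𝒜 N S := by
  obtain ⟨𝒞, -, hC, rfl⟩ := h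
  rintro x y hxy ⟨C, hCC, hx⟩
  refine ⟨C, hCC, ?_⟩
  obtain ⟨f, hf, rfl⟩ := hC C hCC
  simp only [Finset.mem_range, mem_iInter, mem_preimage] at hx ⊢
  exact fun j hj => hxy j hj _ (hf j hj) (hx j hj)

lemma countable_cylinders (T : Ω → Ω) {𝒜 : Set (Set Ω)} (hcnt : 𝒜.Countable) (N : ℕ) :
    {C | IsCylinder T 𝒜 N C}.Countable := by
  have : Countable 𝒜 := hcnt.to_subtype
  refine (countable_range (fun g : Fin N → 𝒜 => ⋂ j ∈ Finset.range N,
    T^[j] ⁻¹' (if h : j < N then (g ⟨j, h⟩ : Set Ω) else univ))).mono ?_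
  rintro C ⟨f, hf, rfl⟩
  refine ⟨fun j => ⟨f j, hf j j.2⟩, ?_⟩
  ext x
  simp only [Finset.mem_range, mem_iInter, mem_preimage]
  refine forall_congr' fun j => forall_congr' fun hj => ?_
  simp [hj]

lemma CylSat.isCylinderUnion {T : Ω → Ω} {𝒜 : Set (Set Ω)} (hcnt : 𝒜.Countable)
    (hdisj : 𝒜.PairwiseDisjoint id) (hcov : ⋃₀ 𝒜 = Set.univ) {N : ℕ} {S : Set Ω}
    (h : CylSat T 𝒜 N S) : IsCylinderUnion T 𝒜 N S := by
  refine ⟨{C | IsCylinder T 𝒜 N C ∧ C ⊆ S},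
    (countable_cylinders T hcnt N).mono fun C hC => hC.1, fun C hC => hC.1, ?_⟩
  apply Subset.antisymm
  · intro x hx
    have hc : ∀ j, ∃ s ∈ 𝒜, T^[j] x ∈ s := fun j => by
      have : T^[j] x ∈ ⋃₀ 𝒜 := hcov ▸ mem_univ _
      exact this
    choose f hf hfx using hc
    refine ⟨⋂ j ∈ Finset.range N, T^[j] ⁻¹' f j, ⟨⟨f, fun j _ => hf j, rfl⟩, ?_⟩, ?_⟩
    · intro y hy
      simp only [Finset.mem_range, mem_iInter, mem_preimage] at hy
      refine h x y (fun j hj s hs hxs => ?_) hx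
      have : f j = s := hdisj.elim_set (hf j) hs _ (hfx j) hxs
      exact this ▸ hy j hj
    · simp only [Finset.mem_range, mem_iInter, mem_preimage]
      exact fun j _ => hfx j
  · exact sUnion_subset fun C hC => hC.2

lemma IsCylinderUnion.measurable_sigma {T : Ω → Ω} {𝒜 : Set (Set Ω)} {N : ℕ} {S : Set Ω}
    (h : IsCylinderUnion T 𝒜 N S) : MeasurableSet[cylinderSigma T 𝒜] S := by
  obtain ⟨𝒞, hc, hC, rfl⟩ := h
  exact MeasurableSet.sUnion hc fun C hCC =>
    MeasurableSpace.measurableSet_generateFrom ⟨N, hC C hCC⟩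

lemma IsCylinderUnion.measurable [MeasurableSpace Ω] {T : Ω → Ω} (hT : Measurable T)
    {𝒜 : Set (Set Ω)} (hms : ∀ s ∈ 𝒜, MeasurableSet s) {N : ℕ} {S : Set Ω}
    (h : IsCylinderUnion T 𝒜 N S) : MeasurableSet S := by
  obtain ⟨𝒞, hc, hC, rfl⟩ := h
  refine MeasurableSet.sUnion hc fun C hCC => ?_
  obtain ⟨f, hf, rfl⟩ := hC C hCC
  exact Finset.measurableSet_biInter _ fun j hj =>
    (hT.iterate j) (hms _ (hf j (Finset.mem_range.1 hj)))

lemma isCylinderUnion_hull (T : Ω → Ω) {𝒜 : Set (Set Ω)} (hcnt : 𝒜.Countable) (w : ℕ)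
    (A : Set Ω) : IsCylinderUnion T 𝒜 w (cylinderHull T 𝒜 w A) :=
  ⟨_, (countable_cylinders T hcnt w).mono fun _ hC => hC.1, fun _ hC => hC.1, rfl⟩

lemma subset_hull (T : Ω → Ω) {𝒜 : Set (Set Ω)} (hcov : ⋃₀ 𝒜 = Set.univ) (w : ℕ)
    (A : Set Ω) : A ⊆ cylinderHull T 𝒜 w A := by
  intro x hx
  have hc : ∀ j, ∃ s ∈ 𝒜, T^[j] x ∈ s := fun j => by
    have : T^[j] x ∈ ⋃₀ 𝒜 := hcov ▸ mem_univ _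
    exact this
  choose f hf hfx using hc
  have hxC : x ∈ ⋂ j ∈ Finset.range w, T^[j] ⁻¹' f j := by
    simp only [Finset.mem_range, mem_iInter, mem_preimage]
    exact fun j _ => hfx j
  exact ⟨_, ⟨⟨f, fun j _ => hf j, rfl⟩, ⟨x, hxC, hx⟩⟩, hxC⟩

/-- Visits to `A` at times `e j`, `j ∈ J`. -/
noncomputable def cnt (T : Ω → Ω) (A : Set Ω) (J : Finset ℕ) (e : ℕ → ℕ) (x : Ω) : ℕ :=
  ∑ j ∈ J, A.indicator (fun _ => 1) (T^[e j] x)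

lemma cnt_congr_of_rel {T : Ω → Ω} {𝒜 : Set (Set Ω)} (hdisj : 𝒜.PairwiseDisjoint id)
    (hcov : ⋃₀ 𝒜 = Set.univ) {A : Set Ω} {n N : ℕ}
    (hA : CylSat T 𝒜 n A) {J : Finset ℕ} {e : ℕ → ℕ} (he : ∀ j ∈ J, e j + n ≤ N) {x y : Ω}
    (hxy : ∀ j < N, ∀ s ∈ 𝒜, T^[j] x ∈ s → T^[j] y ∈ s) :
    cnt T A J e x = cnt T A J e y := by
  have hyx : ∀ j < N, ∀ s ∈ 𝒜, T^[j] y ∈ s → T^[j] x ∈ s := by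
    intro j hj s hs hy
    have : T^[j] x ∈ ⋃₀ 𝒜 := hcov ▸ mem_univ _
    obtain ⟨t, ht, hxt⟩ := this
    have : t = s := hdisj.elim_set ht hs _ (hxy j hj t ht hxt) hy
    exact this ▸ hxt
  refine Finset.sum_congr rfl fun j hj => ?_
  have hiff : T^[e j] x ∈ A ↔ T^[e j] y ∈ A := by
    constructor
    · refine hA _ _ fun l hl s hs h => ?_
      rw [← Function.iterate_add_apply] at h ⊢
      exact hxy _ (by have := he j hj; omega) s hs h
    · refine hA _ _ fun l hl s hs h => ?_
      rw [← Function.iterate_add_apply] at h ⊢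
      exact hyx _ (by have := he j hj; omega) s hs h
  by_cases h : T^[e j] x ∈ A
  · simp [h, hiff.1 h]
  · simp [h, mt hiff.2 h]

lemma cylSat_cnt {T : Ω → Ω} {𝒜 : Set (Set Ω)} (hdisj : 𝒜.PairwiseDisjoint id)
    (hcov : ⋃₀ 𝒜 = Set.univ) {A : Set Ω} {n N : ℕ}
    (hA : CylSat T 𝒜 n A) {J : Finset ℕ} {e : ℕ → ℕ} (he : ∀ j ∈ J, e j + n ≤ N) (b : ℕ) :
    CylSat T 𝒜 N {x | cnt T A J e x = b} := by
  intro x y hxy hx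
  exact (cnt_congr_of_rel hdisj hcov hA he hxy).symm.trans hx

lemma CylSat.mono {T : Ω → Ω} {𝒜 : Set (Set Ω)} {n N : ℕ} {A : Set Ω}
    (hA : CylSat T 𝒜 n A) (h : n ≤ N) : CylSat T 𝒜 N A :=
  fun x y hxy hx => hA x y (fun j hj => hxy j (hj.trans_le h)) hx

lemma CylSat.inter {T : Ω → Ω} {𝒜 : Set (Set Ω)} {N : ℕ} {A B : Set Ω}
    (hA : CylSat T 𝒜 N A) (hB : CylSat T 𝒜 N B) : CylSat T 𝒜 N (A ∩ B) :=
  fun x y hxy hx => ⟨hA x y hxy hx.1, hB x y hxy hx.2⟩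

lemma measurable_cnt [MeasurableSpace Ω] {T : Ω → Ω} (hT : Measurable T) {A : Set Ω}
    (hA : MeasurableSet A) (J : Finset ℕ) (e : ℕ → ℕ) : Measurable (cnt T A J e) := by
  unfold cnt
  exact Finset.measurable_sum _ fun j _ =>
    (measurable_const.indicator hA).comp (hT.iterate (e j))

/-- Changing the count at the times `J0` costs at most the visits at those times. -/
lemma change_count [MeasurableSpace Ω] (μ : Measure Ω) [IsProbabilityMeasure μ]
    (f g : Ω → ℕ) (E : ℕ → Set Ω) (J0 : Finset ℕ) (Q : Set Ω)
    (h : ∀ x, f x ≠ g x → ∃ j ∈ J0, x ∈ E j) (a : ℕ) :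
    |μ.real ({x | f x = a} ∩ Q) - μ.real ({x | g x = a} ∩ Q)| ≤
      ∑ j ∈ J0, μ.real (E j ∩ Q) := by
  have key : ∀ f g : Ω → ℕ, (∀ x, f x ≠ g x → ∃ j ∈ J0, x ∈ E j) →
      μ.real ({x | f x = a} ∩ Q) ≤ μ.real ({x | g x = a} ∩ Q) + ∑ j ∈ J0, μ.real (E j ∩ Q) := by
    intro f g h
    calc μ.real ({x | f x = a} ∩ Q)
        ≤ μ.real (({x | g x = a} ∩ Q) ∪ ⋃ j ∈ J0, (E j ∩ Q)) := by
          apply measureReal_mono _ (measure_ne_top _ _)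
          rintro x ⟨hx, hQ⟩
          by_cases hg : g x = a
          · exact Or.inl ⟨hg, hQ⟩
          · obtain ⟨j, hj, hxj⟩ := h x (by rw [show f x = a from hx]; exact Ne.symm hg)
            right
            simp only [mem_iUnion]
            exact ⟨j, hj, hxj, hQ⟩
      _ ≤ _ := (measureReal_union_le _ _).trans
          (add_le_add le_rfl (measureReal_biUnion_finset_le _ _))
  rw [abs_le]
  have h1 := key f g h
  have h2 := key g f fun x hx => h x (Ne.symm hx)
  constructor <;> linarith

/-- Sum over times within distance `G` of `i`. -/
lemma sum_near (i G : ℕ) (J0 : Finset ℕ) (hJ : ∀ j ∈ J0, j ≠ i ∧ j ≤ i + G ∧ i ≤ j + G)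
    (g : ℕ → ℝ) (hg : ∀ k, 0 ≤ g k) :
    ∑ j ∈ J0, g ((i - j) + (j - i)) ≤ 2 * ∑ k ∈ Finset.Icc 1 G, g k := by
  rw [← Finset.sum_filter_add_sum_filter_not J0 (fun j => j < i), two_mul]
  apply add_le_add
  · rw [← Finset.sum_image (f := g) (s := J0.filter (fun j => j < i)) (g := fun j => (i - j) + (j - i))]
    · apply Finset.sum_le_sum_of_subset_of_nonneg
      · intro k hk
        simp only [Finset.mem_image, Finset.mem_filter, Finset.mem_Icc] at hk ⊢
        obtain ⟨j, ⟨hj, hji⟩, rfl⟩ := hk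
        have := hJ j hj
        omega
      · exact fun k _ _ => hg k
    · intro x hx y hy hxy
      simp at hx hy hxy
      omega
  · rw [← Finset.sum_image (f := g) (s := J0.filter (fun j => ¬ j < i)) (g := fun j => (i - j) + (j - i))]
    · apply Finset.sum_le_sum_of_subset_of_nonneg
      · intro k hk
        simp only [Finset.mem_image, Finset.mem_filter, Finset.mem_Icc] at hk ⊢
        obtain ⟨j, ⟨hj, hji⟩, rfl⟩ := hk
        have := hJ j hj
        omega
      · exact fun k _ _ => hg k
    · intro x hx y hy hxy
      simp at hx hy hxy
      omega

lemma sum_bound (α : ℕ → ℝ) (hα : ∀ k, 0 ≤ α k) (hsum : Summable α) (n G : ℕ) (p d e : ℝ)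
    (hp : 0 ≤ p) (hd : 0 ≤ d) (he : 0 ≤ e) (g : ℕ → ℝ)
    (h1 : ∀ k, 1 ≤ k → k < n → g k ≤ d) (h2 : ∀ k, n ≤ k → k < 2 * n → g k ≤ e)
    (h3 : ∀ k, 2 * n ≤ k → g k ≤ p + α (k - n)) :
    ∑ k ∈ Finset.Icc 1 G, g k ≤ n * d + n * e + G * p + alphaBar α n := by
  have hle : ∀ k ∈ Finset.Icc 1 G, g k ≤ (if k ∈ Finset.Ico 0 n then d else 0) +
      (if k ∈ Finset.Ico n (2 * n) then e else 0) + p +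
      (if k ∈ Finset.Ico (2 * n) (G + 1) then α (k - n) else 0) := by
    intro k hk
    simp only [Finset.mem_Icc, Finset.mem_Ico] at hk ⊢
    rcases lt_or_ge k n with h | h
    · have := h1 k hk.1 h
      rw [if_pos (by omega), if_neg (by omega), if_neg (by omega)]; linarith
    · rcases lt_or_ge k (2 * n) with h' | h'
      · have := h2 k h h'
        rw [if_neg (by omega), if_pos (by omega), if_neg (by omega)]; linarith
      · have := h3 k h'
        rw [if_neg (by omega), if_neg (by omega), if_pos (by omega)]; linarith
  refine (Finset.sum_le_sum hle).trans ?_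
  have hite : ∀ (s : Finset ℕ) (f : ℕ → ℝ), (∀ k, 0 ≤ f k) →
      ∑ k ∈ Finset.Icc 1 G, (if k ∈ s then f k else 0) ≤ ∑ k ∈ s, f k := by
    intro s f hf
    rw [← Finset.sum_filter]
    refine Finset.sum_le_sum_of_subset_of_nonneg ?_ fun k _ _ => hf k
    intro k hk
    exact (Finset.mem_filter.1 hk).2
  simp only [Finset.sum_add_distrib]
  have e1 := hite (Finset.Ico 0 n) (fun _ => d) fun _ => hd
  have e2 := hite (Finset.Ico n (2 * n)) (fun _ => e) fun _ => he
  have e3 := hite (Finset.Ico (2 * n) (G + 1)) (fun k => α (k - n)) fun _ => hα _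
  have e4 : ∑ k ∈ Finset.Ico (2 * n) (G + 1), α (k - n) ≤ alphaBar α n := by
    rw [Finset.sum_Ico_eq_sum_range]
    have hs : Summable fun j => α (n + j) := by
      simpa [add_comm] using (summable_nat_add_iff n).2 hsum
    refine le_trans (le_of_eq ?_) (hs.sum_le_tsum (Finset.range (G + 1 - 2 * n)) fun j _ => hα _)
    refine Finset.sum_congr rfl fun j _ => ?_
    congr 1; omega
  simp only [Finset.sum_const, Nat.card_Ico, nsmul_eq_mul, Nat.sub_zero,
    show 2 * n - n = n by omega] at e1 e2
  simp only [Finset.sum_const, Nat.card_Icc, nsmul_eq_mul, Nat.add_sub_cancel]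
  linarith

end Helpers

set_option maxHeartbeats 4000000 in
/-- Assume `ᾱ(n) < ∞`. There exists `C > 0` such that for all `n`, all
`A ∈ σ(𝒜ⁿ)` with `μ(A) > 0` and `r_A > n/2`, all `m`, all `i ∈ {1,…,m}` and all
`0 ≤ a ≤ m−1`:
`|μ({W_m^i = a} ∩ T^{−i}A) − μ(W_m^i = a)·μ(A)| ≤
  C·μ(A)·inf_Δ (Δ·μ(A) + n·μ(A) + n·δ_A(n) + n·δ_A(r_A) + ᾱ(n) + α(Δ)/μ(A))`. -/
theorem mixing_counting_estimate
    {Ω : Type*} [MeasurableSpace Ω] (μ : Measure Ω) [IsProbabilityMeasure μ]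
    (T : Ω → Ω) (hT : MeasurePreserving T μ μ)
    (𝒜 : Set (Set Ω)) (hcnt : 𝒜.Countable) (hms : ∀ s ∈ 𝒜, MeasurableSet s)
    (hdisj : 𝒜.PairwiseDisjoint id) (hcov : ⋃₀ 𝒜 = Set.univ)
    (α : ℕ → ℝ) (hanti : Antitone α) (hα_lim : Tendsto α atTop (nhds 0)) (hα0 : α 0 = 1)
    (hsum : Summable α)
    (hmix : AlphaMixing μ T 𝒜 α) :
    ∃ C : ℝ, 0 < C ∧ ∀ n : ℕ, 1 ≤ n → ∀ A : Set Ω, IsCylinderUnion T 𝒜 n A →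
      0 < μ A → n < 2 * recTime T A →
      ∀ m i a : ℕ, 1 ≤ i → i ≤ m → a + 1 ≤ m →
        |(μ ({x | visitsAvoid T A m i x = a} ∩ T^[i] ⁻¹' A)).toReal -
            (μ {x | visitsAvoid T A m i x = a}).toReal * (μ A).toReal| ≤
          C * (μ A).toReal *
            sInf ((fun Δ : ℕ => (Δ : ℝ) * (μ A).toReal + n * (μ A).toReal +
              n * deltaA μ T 𝒜 α A n + n * deltaA μ T 𝒜 α A (recTime T A) +
              alphaBar α n + α Δ / (μ A).toReal) '' {Δ : ℕ | 1 ≤ Δ}) := by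
  have hα : ∀ k, 0 ≤ α k := fun k => hanti.le_of_tendsto hα_lim k
  refine ⟨4, by norm_num, ?_⟩
  intro n hn A hAU hApos hr m i a hi him ham
  have hTm : Measurable T := hT.measurable
  have hA : CylSat T 𝒜 n A := hAU.cylSat
  have hAm : MeasurableSet A := hAU.measurable hTm hms
  change |μ.real _ - μ.real _ * μ.real A| ≤ 4 * μ.real A * sInf _
  set p := μ.real A with hpdef
  have hp : 0 < p := by
    exact ENNReal.toReal_pos hApos.ne' (measure_ne_top _ _)
  have hp1 : p ≤ 1 := measureReal_le_one
  have hmp : ∀ (k : ℕ) (S : Set Ω), MeasurableSet S → μ.real (T^[k] ⁻¹' S) = μ.real S := by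
    intro k S hS
    simp only [measureReal_def]
    rw [(hT.iterate k).measure_preimage hS.nullMeasurableSet]
  have hmix' : ∀ (N k M : ℕ) (P B : Set Ω), CylSat T 𝒜 N P → CylSat T 𝒜 M B →
      |μ.real (P ∩ T^[N + k] ⁻¹' B) - μ.real P * μ.real B| ≤ α k * μ.real B :=
    fun N k M P B hP hB => hmix N k P B (hP.isCylinderUnion hcnt hdisj hcov)
      (hB.isCylinderUnion hcnt hdisj hcov).measurable_sigma
  -- short returns
  have hdelta : ∀ k K, 1 ≤ K → K ≤ k → μ.real (A ∩ T^[k] ⁻¹' A) / p ≤ deltaA μ T 𝒜 α A K := by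
    intro k K hK hKk
    refine le_csInf ((nonempty_Icc.2 hK).image _) ?_
    rintro _ ⟨w, ⟨hw1, hwK⟩, rfl⟩
    rw [div_le_iff₀ hp]
    have h1 := hmix' w (k - w) n (cylinderHull T 𝒜 w A) A
      (isCylinderUnion_hull T hcnt w A).cylSat hA
    rw [show w + (k - w) = k by omega] at h1
    have h2 : μ.real (A ∩ T^[k] ⁻¹' A) ≤ μ.real (cylinderHull T 𝒜 w A ∩ T^[k] ⁻¹' A) :=
      measureReal_mono (inter_subset_inter_left _ (subset_hull T hcov w A)) (measure_ne_top _ _)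
    have h3 : α (k - w) ≤ α (K - w) := hanti (by omega)
    have h4 := (abs_le.1 h1).2
    have h5 : α (k - w) * p ≤ α (K - w) * p := mul_le_mul_of_nonneg_right h3 hp.le
    change _ ≤ (μ.real (cylinderHull T 𝒜 w A) + α (K - w)) * p
    rw [add_mul]
    linarith
  have hdelta0 : ∀ K, 0 ≤ deltaA μ T 𝒜 α A K := by
    intro K
    apply Real.sInf_nonneg
    rintro _ ⟨w, -, rfl⟩
    exact add_nonneg ENNReal.toReal_nonneg (hα _)
  have hreturn : ∀ G : ℕ, ∑ k ∈ Finset.Icc 1 G, μ.real (A ∩ T^[k] ⁻¹' A) / p ≤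
      n * deltaA μ T 𝒜 α A (recTime T A) + n * deltaA μ T 𝒜 α A n + G * p + alphaBar α n := by
    intro G
    refine sum_bound α hα hsum n G p _ _ hp.le (hdelta0 _) (hdelta0 _) _ ?_ ?_ ?_
    · intro k hk1 hkn
      rcases lt_or_ge k (recTime T A) with h | h
      · have h' : ¬ (1 ≤ k ∧ (A ∩ T^[k] ⁻¹' A).Nonempty) := Nat.notMem_of_lt_sInf h
        have : A ∩ T^[k] ⁻¹' A = ∅ := by
          by_contra hne
          exact h' ⟨hk1, nonempty_iff_ne_empty.2 hne⟩
        rw [this]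
        simpa using hdelta0 _
      · exact hdelta k _ (by omega) h
    · intro k hk1 hk2
      exact hdelta k n hn hk1
    · intro k hk
      rw [div_le_iff₀ hp]
      have h1 := hmix' n (k - n) n A A hA hA
      rw [show n + (k - n) = k by omega] at h1
      have := (abs_le.1 h1).2
      rw [add_mul]
      linarith
  rw [mul_comm (4 : ℝ) p, mul_assoc, ← div_le_iff₀' hp, ← div_le_iff₀' (by norm_num : (0:ℝ) < 4)]
  refine le_csInf (Set.Nonempty.image _ ⟨1, show 1 ≤ 1 from le_rfl⟩) ?_
  rintro _ ⟨Δ, hΔ, rfl⟩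
  rw [div_le_iff₀' (by norm_num : (0:ℝ) < 4), div_le_iff₀' hp]
  dsimp only
  change _ ≤ p * (4 * ((Δ : ℝ) * p + n * p + n * deltaA μ T 𝒜 α A n +
    n * deltaA μ T 𝒜 α A (recTime T A) + alphaBar α n + α Δ / p))
  set G := Δ + n with hG
  set F := (Finset.Icc 1 m).erase i with hF
  set J1 := F.filter (fun j => j + G < i) with hJ1
  set J2 := F.filter (fun j => i + G < j) with hJ2
  set J0 := F.filter (fun j => j ≤ i + G ∧ i ≤ j + G) with hJ0
  set f : Ω → ℕ := visitsAvoid T A m i with hf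
  set g : Ω → ℕ := fun x => cnt T A J1 id x + cnt T A J2 id x with hg
  have hsplit : ∀ x, f x = g x + cnt T A J0 id x := by
    intro x
    have hu : F = (J1 ∪ J2) ∪ J0 := by
      ext j
      simp only [hJ1, hJ2, hJ0, Finset.mem_union, Finset.mem_filter]
      constructor
      · intro h
        by_cases h1 : j + G < i
        · exact Or.inl (Or.inl ⟨h, h1⟩)
        · by_cases h2 : i + G < j
          · exact Or.inl (Or.inr ⟨h, h2⟩)
          · exact Or.inr ⟨h, by omega, by omega⟩
      · tauto
    have hd1 : Disjoint J1 J2 := by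
      rw [Finset.disjoint_left]
      intro j h1 h2
      have := (Finset.mem_filter.1 h1).2
      have := (Finset.mem_filter.1 h2).2
      omega
    have hd2 : Disjoint (J1 ∪ J2) J0 := by
      rw [Finset.disjoint_left]
      intro j h1 h2
      have h3 := (Finset.mem_filter.1 h2).2
      rcases Finset.mem_union.1 h1 with h | h
      · have := (Finset.mem_filter.1 h).2
        omega
      · have := (Finset.mem_filter.1 h).2
        omega
    change ∑ j ∈ F, A.indicator (fun _ => 1) (T^[j] x) = _
    rw [hu, Finset.sum_union hd2, Finset.sum_union hd1]
    rfl
  have hchange : ∀ x, f x ≠ g x → ∃ j ∈ J0, x ∈ T^[j] ⁻¹' A := by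
    intro x hx
    by_contra hcon
    push Not at hcon
    apply hx
    rw [hsplit x]
    have : cnt T A J0 id x = 0 := Finset.sum_eq_zero fun j hj => by
      have := hcon j hj
      simp only [mem_preimage] at this
      simp [this]
    omega
  have hJ0' : ∀ j ∈ J0, j ≠ i ∧ j ≤ i + G ∧ i ≤ j + G := by
    intro j hj
    have h1 := Finset.mem_filter.1 hj
    exact ⟨Finset.ne_of_mem_erase h1.1, h1.2⟩
  -- step 1
  have hpair : ∀ j, μ.real (T^[j] ⁻¹' A ∩ T^[i] ⁻¹' A) =
      μ.real (A ∩ T^[(i - j) + (j - i)] ⁻¹' A) := by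
    intro j
    have haux : ∀ u v, μ.real (T^[u] ⁻¹' A ∩ T^[v + u] ⁻¹' A) = μ.real (A ∩ T^[v] ⁻¹' A) := by
      intro u v
      rw [← hmp u _ (hAm.inter (hTm.iterate v hAm)), Function.iterate_add]
      rfl
    rcases le_total i j with h | h
    · have := haux i (j - i)
      rw [show j - i + i = j by omega] at this
      rw [inter_comm, this, show i - j + (j - i) = j - i by omega]
    · have := haux j (i - j)
      rw [show i - j + j = i by omega] at this
      rw [this, show i - j + (j - i) = i - j by omega]
  have step1 : |μ.real ({x | f x = a} ∩ T^[i] ⁻¹' A) - μ.real ({x | g x = a} ∩ T^[i] ⁻¹' A)| ≤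
      p * (2 * (n * deltaA μ T 𝒜 α A (recTime T A) + n * deltaA μ T 𝒜 α A n + G * p +
        alphaBar α n)) := by
    refine (change_count μ f g _ J0 _ hchange a).trans ?_
    have h1 : ∀ j ∈ J0, μ.real (T^[j] ⁻¹' A ∩ T^[i] ⁻¹' A) =
        p * ((fun k => μ.real (A ∩ T^[k] ⁻¹' A) / p) ((i - j) + (j - i))) := by
      intro j _
      rw [hpair j]
      field_simp
    rw [Finset.sum_congr rfl h1, ← Finset.mul_sum]
    refine mul_le_mul_of_nonneg_left ?_ hp.le
    refine (sum_near i G J0 hJ0' (fun k => μ.real (A ∩ T^[k] ⁻¹' A) / p) fun k => div_nonneg measureReal_nonneg hp.le).trans ?_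
    exact mul_le_mul_of_nonneg_left (hreturn G) (by norm_num)
  have step2 : |μ.real {x | f x = a} - μ.real {x | g x = a}| ≤ 2 * (G * p) := by
    have h0 := change_count μ f g _ J0 univ hchange a
    simp only [inter_univ] at h0
    refine h0.trans ?_
    have h1 : ∀ j ∈ J0, μ.real (T^[j] ⁻¹' A) = (fun _ => p) ((i - j) + (j - i)) :=
      fun j _ => hmp j A hAm
    rw [Finset.sum_congr rfl h1]
    refine (sum_near i G J0 hJ0' _ fun k => hp.le).trans ?_
    simp
  -- step 3
  set P : ℕ → Set Ω := fun b => {x | cnt T A J1 id x = b} with hP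
  set B : ℕ → Set Ω := fun c => {x | cnt T A J2 (fun j => j - i) x = c} with hB
  have hPm : ∀ b, MeasurableSet (P b) := fun b =>
    measurable_cnt hTm hAm _ _ (measurableSet_singleton b)
  have hBm : ∀ b, MeasurableSet (B b) := fun b =>
    measurable_cnt hTm hAm _ _ (measurableSet_singleton b)
  have hFm : ∀ j ∈ F, j ≤ m := fun j hj => (Finset.mem_Icc.1 (Finset.mem_of_mem_erase hj)).2
  have hBsat : ∀ c, CylSat T 𝒜 (m + n) (B c) := fun c =>
    cylSat_cnt hdisj hcov hA (fun j hj => by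
      have := hFm j (Finset.mem_filter.1 hj).1
      omega) c
  have hpast : ∀ b (S : Set Ω), MeasurableSet S → CylSat T 𝒜 (m + n) S →
      |μ.real (P b ∩ T^[i] ⁻¹' S) - μ.real (P b) * μ.real S| ≤ α Δ * μ.real S := by
    intro b S hSm hS
    rcases lt_or_ge i (G + 1) with h | h
    · have hJ1e : J1 = ∅ := by
        rw [hJ1, Finset.filter_eq_empty_iff]
        intro j _
        omega
      have hnn : 0 ≤ α Δ * μ.real S := mul_nonneg (hα _) measureReal_nonneg
      by_cases hb : b = 0
      · have : P b = univ := by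
          ext x; simp [hP, hJ1e, cnt, hb]
        rw [this, univ_inter, hmp i S hSm]
        simpa using hnn
      · have : P b = ∅ := by
          ext x; simp [hP, hJ1e, cnt, Ne.symm hb]
        rw [this]
        simpa using hnn
    · have hPs : CylSat T 𝒜 (i - Δ) (P b) := cylSat_cnt hdisj hcov hA (fun j hj => by
        have := (Finset.mem_filter.1 hj).2
        simp only [id]
        omega) b
      have := hmix' (i - Δ) Δ _ _ _ hPs hS
      rwa [show i - Δ + Δ = i by omega] at this
  have hfut : ∀ c, |μ.real (A ∩ B c) - p * μ.real (B c)| ≤ α Δ * μ.real (B c) := by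
    intro c
    set B' : Set Ω := {x | cnt T A J2 (fun j => j - i - G) x = c} with hB'
    have hB'm : MeasurableSet B' := measurable_cnt hTm hAm _ _ (measurableSet_singleton c)
    have hB's : CylSat T 𝒜 (m + n) B' := cylSat_cnt hdisj hcov hA (fun j hj => by
      have := hFm j (Finset.mem_filter.1 hj).1
      omega) c
    have hBB : B c = T^[G] ⁻¹' B' := by
      ext x
      have : cnt T A J2 (fun j => j - i) x = cnt T A J2 (fun j => j - i - G) (T^[G] x) := by
        refine Finset.sum_congr rfl fun j hj => ?_
        have := (Finset.mem_filter.1 hj).2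
        rw [← Function.iterate_add_apply, show j - i - G + G = j - i by omega]
      simp only [hB, hB', mem_preimage, mem_setOf_eq, this]
    have h1 := hmix' n Δ _ _ _ hA hB's
    rw [show n + Δ = G by omega, ← hBB, ← hmp G B' hB'm, ← hBB] at h1
    exact h1
  have hdecomp : ∀ Q : Set Ω, MeasurableSet Q → μ.real ({x | g x = a} ∩ T^[i] ⁻¹' Q) =
      ∑ b ∈ Finset.range (a + 1), μ.real (P b ∩ T^[i] ⁻¹' (Q ∩ B (a - b))) := by
    intro Q hQ
    have hcnt2 : ∀ x, cnt T A J2 (fun j => j - i) (T^[i] x) = cnt T A J2 id x := by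
      intro x
      refine Finset.sum_congr rfl fun j hj => ?_
      have := (Finset.mem_filter.1 hj).2
      rw [← Function.iterate_add_apply, show j - i + i = j by omega]
      rfl
    rw [← measureReal_biUnion_finset]
    · congr 1
      ext x
      simp only [hg, hP, hB, mem_inter_iff, mem_setOf_eq, mem_preimage, mem_iUnion,
        Finset.mem_range, hcnt2, exists_prop]
      constructor
      · rintro ⟨h1, h2⟩
        exact ⟨_, by omega, rfl, h2, by omega⟩
      · rintro ⟨b, hb, h1, h2, h3⟩
        exact ⟨by omega, h2⟩
    · intro b _ b' _ hbb
      refine Set.disjoint_left.2 ?_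
      rintro x ⟨h1, -⟩ ⟨h2, -⟩
      exact hbb (h1.symm.trans h2)
    · intro b _
      exact (hPm b).inter (hTm.iterate i (hQ.inter (hBm _)))
  have hBsum : ∑ b ∈ Finset.range (a + 1), μ.real (B (a - b)) ≤ 1 := by
    rw [← measureReal_biUnion_finset]
    · exact measureReal_le_one
    · intro b hb b' hb' hbb
      refine Set.disjoint_left.2 ?_
      intro x h1 h2
      have h3 : a - b = a - b' := h1.symm.trans h2
      simp at hb hb'
      omega
    · intro b _
      exact hBm _
  have step3 : |μ.real ({x | g x = a} ∩ T^[i] ⁻¹' A) - μ.real {x | g x = a} * p| ≤ 3 * α Δ := by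
    have h1 := hdecomp A hAm
    have h2 := hdecomp univ MeasurableSet.univ
    simp only [preimage_univ, inter_univ, univ_inter] at h2
    rw [h1, h2, Finset.sum_mul, ← Finset.sum_sub_distrib]
    refine (Finset.abs_sum_le_sum_abs _ _).trans ?_
    have hterm : ∀ b ∈ Finset.range (a + 1),
        |μ.real (P b ∩ T^[i] ⁻¹' (A ∩ B (a - b))) - μ.real (P b ∩ T^[i] ⁻¹' B (a - b)) * p| ≤
          3 * α Δ * μ.real (B (a - b)) := by
      intro b _
      have t1 := hpast b (A ∩ B (a - b)) (hAm.inter (hBm _)) ((hA.mono (by omega)).inter (hBsat _))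
      have t2 := hfut (a - b)
      have t3 := hpast b (B (a - b)) (hBm _) (hBsat _)
      have t4 : μ.real (A ∩ B (a - b)) ≤ μ.real (B (a - b)) :=
        measureReal_mono inter_subset_right (measure_ne_top _ _)
      have t5 : μ.real (P b) ≤ 1 := measureReal_le_one
      have t6 : 0 ≤ μ.real (P b) := measureReal_nonneg
      set β := μ.real (B (a - b))
      have hβ : 0 ≤ α Δ * β := mul_nonneg (hα _) measureReal_nonneg
      have u1 : α Δ * μ.real (A ∩ B (a - b)) ≤ α Δ * β := mul_le_mul_of_nonneg_left t4 (hα _)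
      have u2 : |μ.real (P b) * (μ.real (A ∩ B (a - b)) - p * β)| ≤ α Δ * β := by
        rw [abs_mul, abs_of_nonneg t6]
        calc _ ≤ 1 * (α Δ * β) := mul_le_mul t5 t2 (abs_nonneg _) zero_le_one
          _ = _ := one_mul _
      have u3 : |p * (μ.real (P b ∩ T^[i] ⁻¹' B (a - b)) - μ.real (P b) * β)| ≤ α Δ * β := by
        rw [abs_mul, abs_of_nonneg hp.le]
        calc _ ≤ 1 * (α Δ * β) := mul_le_mul hp1 t3 (abs_nonneg _) zero_le_one
          _ = _ := one_mul _
      rw [abs_le] at t1 u2 u3 ⊢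
      constructor <;> nlinarith [t1.1, t1.2, u2.1, u2.2, u3.1, u3.2]
    refine (Finset.sum_le_sum hterm).trans ?_
    rw [← Finset.mul_sum]
    have : 0 ≤ 3 * α Δ := mul_nonneg (by norm_num) (hα _)
    nlinarith
  have step2' : |μ.real {x | f x = a} * p - μ.real {x | g x = a} * p| ≤ p * (2 * (G * p)) := by
    rw [← sub_mul, abs_mul, abs_of_pos hp, mul_comm]
    exact mul_le_mul_of_nonneg_left step2 hp.le
  have hGc : (G : ℝ) = Δ + n := by rw [hG]; push_cast; rfl
  have habar : 0 ≤ alphaBar α n := tsum_nonneg fun j => hα _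
  have hfin : p * (4 * ((Δ : ℝ) * p + n * p + n * deltaA μ T 𝒜 α A n +
      n * deltaA μ T 𝒜 α A (recTime T A) + alphaBar α n + α Δ / p)) =
      p * (4 * ((Δ : ℝ) * p + n * p + n * deltaA μ T 𝒜 α A n +
      n * deltaA μ T 𝒜 α A (recTime T A) + alphaBar α n)) + 4 * α Δ := by
    field_simp
  rw [hfin]
  have v1 : 0 ≤ p * (n * deltaA μ T 𝒜 α A n) :=
    mul_nonneg hp.le (mul_nonneg n.cast_nonneg (hdelta0 _))
  have v2 : 0 ≤ p * (n * deltaA μ T 𝒜 α A (recTime T A)) :=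
    mul_nonneg hp.le (mul_nonneg n.cast_nonneg (hdelta0 _))
  have v3 : 0 ≤ p * alphaBar α n := mul_nonneg hp.le habar
  have v4 := hα Δ
  rw [hGc] at step1 step2'
  rw [abs_le] at step1 step2' step3 ⊢
  constructor <;> nlinarith [step1.1, step1.2, step2'.1, step2'.2, step3.1, step3.2]
end
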